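/- Let (G, λ) be an MAT-labeled graph, let e = {i, j} be an edge of label k, and let h_1, ..., h_{k-1} be the conditioning vertices of e. Then K_e := {i, j, h_1, ..., h_{k-1}} is a clique of G, the restriction of λ to the induced subgraph G[K_e] is an MAT-labeling, and every edge of G[K_e] other than e has label < k. -/

import Mathlib

/-- An edge-labeling `lab : Sym2 V → ℕ` of a simple graph `G` is an MAT-labeling if
labels of edges are positive, (ML1) for every `k`, no edge of label `≤ k` forms a cycle
with edges of label `k` (i.e. the graph whose edges are the label-`k` edges together
with that edge is acyclic), and (ML2) every edge of label `k` forms exactly `k - 1`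
triangles with edges of smaller label. -/
def MATLabeling {V : Type*} (G : SimpleGraph V) (lab : Sym2 V → ℕ) : Prop :=
  (∀ e ∈ G.edgeSet, 1 ≤ lab e) ∧
  (∀ k : ℕ, ∀ e ∈ G.edgeSet, lab e ≤ k →
    (SimpleGraph.fromEdgeSet {f | (f ∈ G.edgeSet ∧ lab f = k) ∨ f = e}).IsAcyclic) ∧
  (∀ i j : V, G.Adj i j →
    {w : V | G.Adj w i ∧ G.Adj w j ∧ lab s(w, i) < lab s(i, j) ∧
      lab s(w, j) < lab s(i, j)}.ncard = lab s(i, j) - 1)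

/-- A vertex `v` is MAT-simplicial in the edge-labeled graph `(G, lab)`:
(MS1) `v` is simplicial; (MS2) the labels of the edges incident on `v` are exactly
`{1, …, deg v}`; (MS3) for distinct neighbors `u₁ u₂` of `v`,
`lab (u₁, u₂) < max (lab (u₁, v)) (lab (u₂, v))`. -/
def MATSimplicial {V : Type*} (G : SimpleGraph V) (lab : Sym2 V → ℕ) (v : V) : Prop :=
  (∀ u₁ ∈ G.neighborSet v, ∀ u₂ ∈ G.neighborSet v, u₁ ≠ u₂ → G.Adj u₁ u₂) ∧
  ((fun u => lab s(u, v)) '' G.neighborSet v = Set.Icc 1 (G.neighborSet v).ncard) ∧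
  (∀ u₁ ∈ G.neighborSet v, ∀ u₂ ∈ G.neighborSet v, u₁ ≠ u₂ →
    lab s(u₁, u₂) < max (lab s(u₁, v)) (lab s(u₂, v)))

/-- The conditioning vertices of the edge `{i, j}`: vertices joined to both endpoints
by edges of label smaller than `lab s(i, j)`. -/
def condVerts {V : Type*} (G : SimpleGraph V) (lab : Sym2 V → ℕ) (i j : V) : Set V :=
  {w : V | G.Adj w i ∧ G.Adj w j ∧ lab s(w, i) < lab s(i, j) ∧ lab s(w, j) < lab s(i, j)}

/-- The principal clique generated by the edge `{i, j}`: its endpoints together with its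
conditioning vertices. -/
def principalClique {V : Type*} (G : SimpleGraph V) (lab : Sym2 V → ℕ) (i j : V) : Set V :=
  {i, j} ∪ condVerts G lab i j

/-- A set of vertices is a principal clique if it is the principal clique generated by
some edge of `G`. -/
def IsPrincipalClique {V : Type*} (G : SimpleGraph V) (lab : Sym2 V → ℕ) (C : Set V) :
    Prop :=
  ∃ i j : V, G.Adj i j ∧ C = principalClique G lab i j

namespace SimpleGraph

variable {V : Type*}

/-- `u` and `v` are joined by a walk of `G` all of whose vertices lie in `X` (or `u = v`). -/
def ReachIn (G : SimpleGraph V) (X : Set V) : V → V → Prop :=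
  Relation.ReflTransGen fun u v => G.Adj u v ∧ u ∈ X ∧ v ∈ X

/-- A form of chordality: whenever two neighbors of `s` are joined by a walk avoiding `s`, they
are joined by a walk through neighbors of `s` on the same vertices. -/
def NeighborConnected (G : SimpleGraph V) : Prop :=
  ∀ ⦃X : Set V⦄ ⦃s a b : V⦄, s ∉ X → G.Adj s a → G.Adj s b → a ∈ X → b ∈ X →
    G.ReachIn X a b → G.ReachIn (X ∩ G.neighborSet s) a b

variable {G G' : SimpleGraph V} {X Y : Set V} {a b u v w : V}

lemma ReachIn.mono (hG : G ≤ G') (hX : X ⊆ Y) (h : G.ReachIn X u v) : G'.ReachIn Y u v :=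
  Relation.ReflTransGen.mono (fun _ _ h => ⟨hG h.1, hX h.2.1, hX h.2.2⟩) _ _ h

lemma ReachIn.symm (h : G.ReachIn X u v) : G.ReachIn X v u := by
  induction h with
  | refl => exact .refl
  | tail _ h ih => exact .head ⟨h.1.symm, h.2.2, h.2.1⟩ ih

lemma ReachIn.trans (h : G.ReachIn X u v) (h' : G.ReachIn X v w) : G.ReachIn X u w :=
  Relation.ReflTransGen.trans h h'

lemma Adj.reachIn (h : G.Adj u v) (hu : u ∈ X) (hv : v ∈ X) : G.ReachIn X u v :=
  .single ⟨h, hu, hv⟩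

lemma ReachIn.of_sup_edge (h : (G ⊔ edge a b).ReachIn X u v) :
    G.ReachIn X u v ∨ (a ∈ X ∧ b ∈ X ∧
      ((G.ReachIn X u a ∧ G.ReachIn X b v) ∨ (G.ReachIn X u b ∧ G.ReachIn X a v))) := by
  induction h with
  | refl => exact .inl .refl
  | tail _ h ih =>
    obtain ⟨hadj, hw, hw'⟩ := h
    rw [sup_adj, edge_adj] at hadj
    obtain hadj | ⟨⟨rfl, rfl⟩ | ⟨rfl, rfl⟩, -⟩ := hadj
    · have hr := hadj.reachIn hw hw'
      obtain h1 | ⟨ha, hb, ⟨h1, h2⟩ | ⟨h1, h2⟩⟩ := ih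
      · exact .inl (h1.trans hr)
      · exact .inr ⟨ha, hb, .inl ⟨h1, h2.trans hr⟩⟩
      · exact .inr ⟨ha, hb, .inr ⟨h1, h2.trans hr⟩⟩
    · obtain h1 | ⟨ha, hb, ⟨h1, h2⟩ | ⟨h1, h2⟩⟩ := ih
      · exact .inr ⟨hw, hw', .inl ⟨h1, .refl⟩⟩
      · exact .inr ⟨hw, hw', .inl ⟨h1, .refl⟩⟩
      · exact .inl h1
    · obtain h1 | ⟨ha, hb, ⟨h1, h2⟩ | ⟨h1, h2⟩⟩ := ih
      · exact .inr ⟨hw', hw, .inr ⟨h1, .refl⟩⟩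
      · exact .inl h1
      · exact .inr ⟨hw', hw, .inr ⟨h1, .refl⟩⟩

lemma exists_mem_commonNeighbors_of_reachIn
    (hsep : ¬ G.ReachIn (G.commonNeighbors a b)ᶜ a b) (h : G.ReachIn X a b) :
    ∃ c ∈ X, G.Adj a c ∧ G.Adj b c := by
  by_contra! hc
  exact hsep (h.mono le_rfl fun x hx hx' => hc x hx hx'.1 hx'.2)

lemma NeighborConnected.sup_edge_left (hC : G.NeighborConnected)
    (hsep : ¬ G.ReachIn (G.commonNeighbors a b)ᶜ a b) (ha : a ∉ X)
    (hu : (G ⊔ edge a b).Adj a u) (hv : (G ⊔ edge a b).Adj a v) (huX : u ∈ X) (hvX : v ∈ X)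
    (h : (G ⊔ edge a b).ReachIn X u v) :
    (G ⊔ edge a b).ReachIn (X ∩ (G ⊔ edge a b).neighborSet a) u v := by
  have hr : G.ReachIn X u v := h.of_sup_edge.resolve_right fun h => ha h.1
  have hsub : X ∩ G.neighborSet a ⊆ X ∩ (G ⊔ edge a b).neighborSet a :=
    fun x hx => ⟨hx.1, .inl hx.2⟩
  have key : ∀ v, v ∈ X → G.Adj a v → b ∈ X → (G ⊔ edge a b).Adj a b → G.ReachIn X b v →
      (G ⊔ edge a b).ReachIn (X ∩ (G ⊔ edge a b).neighborSet a) b v := by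
    intro v hvX hav hbX hab hbv
    have hba : G.ReachIn (insert a X) a b :=
      ((hbv.mono le_rfl (Set.subset_insert a X)).trans
        (hav.symm.reachIn (.inr hvX) (.inl rfl))).symm
    obtain ⟨c, hcX, hac, hbc⟩ := exists_mem_commonNeighbors_of_reachIn hsep hba
    have hcX : c ∈ X := hcX.resolve_left hac.ne'
    refine ReachIn.trans (Adj.reachIn (.inl hbc) ⟨hbX, hab⟩ ⟨hcX, .inl hac⟩) ?_
    exact (hC ha hac hav hcX hvX ((hbc.symm.reachIn hcX hbX).trans hbv)).mono le_sup_left hsub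
  have hb : ∀ {x}, (G ⊔ edge a b).Adj a x → G.Adj a x ∨ x = b := by
    intro x hx
    rw [sup_adj, edge_adj] at hx
    grind
  obtain hu' | rfl := hb hu <;> obtain hv' | rfl := hb hv
  · exact (hC ha hu' hv' huX hvX hr).mono le_sup_left hsub
  · exact (key u huX hu' hvX hv hr.symm).symm
  · exact key v hvX hv' huX hu hr
  · exact .refl

lemma NeighborConnected.sup_edge (hC : G.NeighborConnected)
    (hsep : ¬ G.ReachIn (G.commonNeighbors a b)ᶜ a b) : (G ⊔ edge a b).NeighborConnected := by
  intro X s u v hs hsu hsv hu hv h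
  have hab : a ≠ b := fun hab => hsep (hab ▸ .refl)
  by_cases hsa : s = a
  · subst hsa
    exact hC.sup_edge_left hsep hs hsu hsv hu hv h
  by_cases hsb : s = b
  · subst hsb
    rw [edge_comm] at *
    refine hC.sup_edge_left (fun h' => hsep ?_) hs hsu hsv hu hv h
    rw [commonNeighbors_symm]
    exact h'.symm
  have hadj : ∀ {x}, (G ⊔ edge a b).Adj s x → G.Adj s x := by
    intro x hx
    rw [sup_adj, edge_adj] at hx
    grind
  have hsub : X ∩ G.neighborSet s ⊆ X ∩ (G ⊔ edge a b).neighborSet s :=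
    fun x hx => ⟨hx.1, .inl hx.2⟩
  have key : ∀ u v, u ∈ X → v ∈ X → G.Adj s u → G.Adj s v → a ∈ X → b ∈ X →
      G.ReachIn X u a → G.ReachIn X b v →
      (G ⊔ edge a b).ReachIn (X ∩ (G ⊔ edge a b).neighborSet s) u v := by
    intro u v hu hv hsu hsv ha hb hua hbv
    by_cases hc : G.Adj s a ∧ G.Adj s b
    · refine ((hC hs hsu hc.1 hu ha hua).mono le_sup_left hsub).trans
        (ReachIn.trans (Adj.reachIn (.inr ?_) ⟨ha, .inl hc.1⟩ ⟨hb, .inl hc.2⟩)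
          ((hC hs hc.2 hsv hb hv hbv).mono le_sup_left hsub))
      rw [edge_adj]
      grind
    · have hX := Set.subset_insert s X
      have hr : G.ReachIn (insert s X) a b :=
        (hua.symm.mono le_rfl hX).trans <| (hsu.symm.reachIn (.inr hu) (.inl rfl)).trans <|
          (hsv.reachIn (.inl rfl) (.inr hv)).trans (hbv.symm.mono le_rfl hX)
      obtain ⟨c, hcX, hac, hbc⟩ := exists_mem_commonNeighbors_of_reachIn hsep hr
      have hcX : c ∈ X := hcX.resolve_left fun h => hc (h ▸ ⟨hac.symm, hbc.symm⟩)
      exact (hC hs hsu hsv hu hv (hua.trans <| (hac.reachIn ha hcX).trans <|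
        (hbc.symm.reachIn hcX hb).trans hbv)).mono le_sup_left hsub
  obtain h1 | ⟨ha, hb, ⟨h1, h2⟩ | ⟨h1, h2⟩⟩ := h.of_sup_edge
  · exact (hC hs (hadj hsu) (hadj hsv) hu hv h1).mono le_sup_left hsub
  · exact key u v hu hv (hadj hsu) (hadj hsv) ha hb h1 h2
  · exact (key v u hv hu (hadj hsv) (hadj hsu) ha hb h2.symm h1.symm).symm

lemma NeighborConnected.isClique_commonNeighbors (hC : G.NeighborConnected) (hab : a ≠ b)
    (hnadj : ¬ G.Adj a b) : G.IsClique (G.commonNeighbors a b) := by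
  rintro s ⟨has, hbs⟩ t ⟨hat, hbt⟩ hst
  by_contra hn
  have hs : s ∉ ({a, b, t} : Set V) := by
    have := has.ne'
    have := hbs.ne'
    grind
  have hr := hC hs has.symm hbs.symm (by simp) (by simp)
    (ReachIn.trans (hat.reachIn (by simp) (by simp)) (hbt.symm.reachIn (by simp) (by simp)))
  obtain h | ⟨c, ⟨hac, -, hc, hsc⟩, -⟩ := Relation.ReflTransGen.cases_head hr
  · exact hab h
  · obtain rfl | rfl | rfl := hc
    · exact hac.ne rfl
    · exact hnadj hac
    · exact hn hsc

lemma NeighborConnected.reachIn_inter (hC : G.NeighborConnected) (S : Finset V)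
    (hS : ∀ s ∈ S, s ∉ X) (ha : a ∈ X) (hb : b ∈ X) (haS : ∀ s ∈ S, G.Adj a s)
    (hbS : ∀ s ∈ S, G.Adj b s) (h : G.ReachIn X a b) :
    G.ReachIn (X ∩ {x | ∀ s ∈ S, G.Adj x s}) a b := by
  classical
  induction S using Finset.induction_on with
  | empty => simpa using h
  | insert s S _ ih =>
    simp only [Finset.mem_insert, forall_eq_or_imp] at hS haS hbS
    refine (hC (X := X ∩ {x | ∀ t ∈ S, G.Adj x t}) (fun hs => hS.1 hs.1) haS.1.symm hbS.1.symm
      ⟨ha, haS.2⟩ ⟨hb, hbS.2⟩ (ih hS.2 haS.2 hbS.2)).mono le_rfl ?_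
    rintro x ⟨⟨hx, hxS⟩, hxs⟩
    refine ⟨hx, fun t ht => ?_⟩
    obtain rfl | ht := Finset.mem_insert.1 ht
    · exact hxs.symm
    · exact hxS t ht

lemma NeighborConnected.eq_of_reachIn_compl (hC : G.NeighborConnected) {S : Finset V} {n : ℕ}
    (hS : G.IsNClique n S) (hfree : G.CliqueFree (n + 2)) (haS : ∀ s ∈ S, G.Adj a s)
    (hbS : ∀ s ∈ S, G.Adj b s) (h : G.ReachIn (S : Set V)ᶜ a b) : a = b := by
  classical
  have hr := hC.reachIn_inter (X := (S : Set V)ᶜ) S (by simp) (fun ha => (haS a ha).ne rfl)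
    (fun hb => (hbS b hb).ne rfl) haS hbS h
  obtain h | ⟨c, ⟨hac, -, -, hc⟩, -⟩ := Relation.ReflTransGen.cases_head hr
  · exact h
  · refine absurd ((hS.insert hc).insert (a := a) ?_) (hfree _)
    simpa using ⟨hac, haS⟩

lemma NeighborConnected.not_reachIn_sup (hC : G.NeighborConnected) {n : ℕ}
    (hfree : G.CliqueFree (n + 2)) {F F' : SimpleGraph V} (hF : F.IsAcyclic)
    (hcard : ∀ a b, F.Adj a b → ¬ G.Adj a b ∧ (G.commonNeighbors a b).encard = n)
    (hab : F.Adj a b) (hF' : F' ≤ F) (hab' : ¬ F'.Adj a b) :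
    ¬ (G ⊔ F').ReachIn (G.commonNeighbors a b)ᶜ a b := by
  obtain ⟨hnadj, hn⟩ := hcard a b hab
  have hcl := hC.isClique_commonNeighbors hab.ne hnadj
  obtain ⟨S, hS⟩ := (Set.finite_of_encard_eq_coe hn).exists_finset_coe
  have hmem : ∀ s, s ∈ S ↔ G.Adj a s ∧ G.Adj b s := by
    intro s
    rw [← Finset.mem_coe, hS, mem_commonNeighbors]
  rw [← hS] at hcl hn ⊢
  have hncl : G.IsNClique n S := ⟨hcl, by simpa using hn⟩
  have hbr := isBridge_iff.1 (isAcyclic_iff_forall_adj_isBridge.1 hF hab)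
  have hnr : ¬ F'.Reachable a b := by
    refine fun h => hbr (h.mono fun x y hxy => ?_)
    rw [deleteEdges_adj]
    refine ⟨hF' hxy, fun he => hab' ?_⟩
    rwa [← mem_edgeSet, ← Set.mem_singleton_iff.1 he, mem_edgeSet]
  intro hr
  have key : ∀ w, (G ⊔ F').ReachIn (S : Set V)ᶜ a w →
      ∃ x, (∀ s ∈ S, G.Adj x s) ∧ G.ReachIn (S : Set V)ᶜ w x ∧ F'.Reachable a x := by
    intro w hw
    induction hw with
    | refl => exact ⟨a, fun s hs => ((hmem s).1 hs).1, .refl, .refl _⟩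
    | @tail w w' _ h ih =>
      obtain ⟨x, hxS, hwx, hax⟩ := ih
      obtain ⟨hadj, hw, hw'⟩ := h
      by_cases hww : G.ReachIn (S : Set V)ᶜ w w'
      · exact ⟨x, hxS, hww.symm.trans hwx, hax⟩
      have hadj : F'.Adj w w' := hadj.resolve_left fun h => hww (h.reachIn hw hw')
      have hsub : G.commonNeighbors w w' ⊆ S := by
        rintro c ⟨hc, hc'⟩
        by_contra hcS
        exact hww ((hc.reachIn hw hcS).trans (hc'.symm.reachIn hcS hw'))
      have heq := S.finite_toSet.eq_of_subset_of_encard_le' hsub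
        (by rw [hn, (hcard w w' (hF' hadj)).2])
      have hfull : ∀ s ∈ S, G.Adj w s ∧ G.Adj w' s := by
        intro s hs
        rwa [← Finset.mem_coe, ← heq, mem_commonNeighbors] at hs
      obtain rfl := hC.eq_of_reachIn_compl hncl hfree (fun s hs => (hfull s hs).1) hxS hwx
      exact ⟨w', fun s hs => (hfull s hs).2, .refl, hax.trans hadj.reachable⟩
  obtain ⟨x, hxS, hbx, hax⟩ := key b hr
  obtain rfl := hC.eq_of_reachIn_compl hncl hfree (fun s hs => ((hmem s).1 hs).2) hxS hbx
  exact hnr hax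

lemma NeighborConnected.sup_fromEdgeSet_finset (hC : G.NeighborConnected) {n : ℕ}
    (hfree : G.CliqueFree (n + 2)) {F : SimpleGraph V} (hF : F.IsAcyclic)
    (hcard : ∀ a b, F.Adj a b → ¬ G.Adj a b ∧ (G.commonNeighbors a b).encard = n)
    (E : Finset (Sym2 V)) (hE : (E : Set (Sym2 V)) ⊆ F.edgeSet) :
    (G ⊔ fromEdgeSet (E : Set (Sym2 V))).NeighborConnected := by
  classical
  induction E using Finset.induction_on with
  | empty => simpa using hC
  | insert e E he ih =>
    induction e with | _ a b
    rw [Finset.coe_insert, Set.insert_subset_iff] at hE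
    have hsup : G ⊔ fromEdgeSet ((insert s(a, b) E : Finset (Sym2 V)) : Set (Sym2 V)) =
        (G ⊔ fromEdgeSet (E : Set (Sym2 V))) ⊔ edge a b := by
      rw [Finset.coe_insert, Set.insert_eq, edge, sup_assoc, ← fromEdgeSet_union, Set.union_comm]
    rw [hsup]
    refine (ih hE.2).sup_edge fun h => ?_
    refine hC.not_reachIn_sup hfree hF hcard hE.1 (F' := fromEdgeSet E) ?_ ?_ (h.mono le_rfl ?_)
    · intro x y hxy
      exact hE.2 ((fromEdgeSet_adj _).1 hxy).1
    · exact fun h => he ((fromEdgeSet_adj _).1 h).1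
    · exact Set.compl_subset_compl.2 fun c hc => ⟨.inl hc.1, .inl hc.2⟩

lemma ReachIn.exists_finset {F : SimpleGraph V} (h : (G ⊔ F).ReachIn X u v) :
    ∃ E : Finset (Sym2 V), (E : Set (Sym2 V)) ⊆ F.edgeSet ∧
      (G ⊔ fromEdgeSet (E : Set (Sym2 V))).ReachIn X u v := by
  classical
  induction h with
  | refl => exact ⟨∅, by simp, .refl⟩
  | @tail w w' _ h ih =>
    obtain ⟨E, hE, hr⟩ := ih
    obtain ⟨hadj | hadj, hw, hw'⟩ := h
    · exact ⟨E, hE, hr.trans (Adj.reachIn (.inl hadj) hw hw')⟩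
    · refine ⟨insert s(w, w') E, by simpa [Set.insert_subset_iff] using ⟨hadj, hE⟩, ?_⟩
      refine ReachIn.trans (hr.mono (sup_le_sup_left (fromEdgeSet_mono (by simp)) _) le_rfl)
        (Adj.reachIn (.inr ?_) hw hw')
      simpa using hadj.ne

lemma NeighborConnected.sup (hC : G.NeighborConnected) {n : ℕ}
    (hfree : G.CliqueFree (n + 2)) {F : SimpleGraph V} (hF : F.IsAcyclic)
    (hcard : ∀ a b, F.Adj a b → ¬ G.Adj a b ∧ (G.commonNeighbors a b).encard = n) :
    (G ⊔ F).NeighborConnected := by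
  intro X s u v hs hsu hsv hu hv h
  classical
  obtain ⟨E, hE, hr⟩ := h.exists_finset
  let E' : Finset (Sym2 V) := E ∪ ({s(s, u), s(s, v)} : Finset (Sym2 V)).filter (· ∈ F.edgeSet)
  have hE' : (E' : Set (Sym2 V)) ⊆ F.edgeSet := by
    intro e he
    obtain he | he := Finset.mem_union.1 he
    · exact hE he
    · exact (Finset.mem_filter.1 he).2
  have hle : G ⊔ fromEdgeSet (E' : Set (Sym2 V)) ≤ G ⊔ F :=
    sup_le_sup_left (fun x y hxy => hE' ((fromEdgeSet_adj _).1 hxy).1) _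
  refine (hC.sup_fromEdgeSet_finset hfree hF hcard E' hE' hs ?_ ?_ hu hv
    (hr.mono (sup_le_sup_left (fromEdgeSet_mono (by simp [E'])) _) le_rfl)).mono hle
    fun x hx => ⟨hx.1, hle hx.2⟩
  · refine hsu.imp_right fun h => (fromEdgeSet_adj _).2 ⟨?_, h.ne⟩
    simp [E', h]
  · refine hsv.imp_right fun h => (fromEdgeSet_adj _).2 ⟨?_, h.ne⟩
    simp [E', h]

end SimpleGraph

namespace MATLabeling

variable {V : Type*} {G : SimpleGraph V} {lab : Sym2 V → ℕ}

/-- The graph of the edges of label at most `n`. -/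
def lowGraph (G : SimpleGraph V) (lab : Sym2 V → ℕ) (n : ℕ) : SimpleGraph V where
  Adj u v := G.Adj u v ∧ lab s(u, v) ≤ n
  symm := ⟨fun _ _ h => ⟨h.1.symm, Sym2.eq_swap ▸ h.2⟩⟩
  loopless := ⟨fun _ h => h.1.ne rfl⟩

/-- The graph of the edges of label `n`. -/
def levelGraph (G : SimpleGraph V) (lab : Sym2 V → ℕ) (n : ℕ) : SimpleGraph V where
  Adj u v := G.Adj u v ∧ lab s(u, v) = n
  symm := ⟨fun _ _ h => ⟨h.1.symm, Sym2.eq_swap ▸ h.2⟩⟩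
  loopless := ⟨fun _ h => h.1.ne rfl⟩

lemma condVerts_eq_commonNeighbors {n : ℕ} {a b : V} (hlab : lab s(a, b) = n + 1) :
    condVerts G lab a b = (lowGraph G lab n).commonNeighbors a b := by
  ext w
  rw [SimpleGraph.mem_commonNeighbors]
  simp only [condVerts, Set.mem_ofPred_eq, lowGraph, hlab, Nat.lt_succ_iff, G.adj_comm w,
    Sym2.eq_swap (a := w)]
  tauto

lemma encard_condVerts (h : MATLabeling G lab) {n : ℕ} {a b : V} (hab : G.Adj a b)
    (hlab : lab s(a, b) = n + 1) : (condVerts G lab a b).encard = n := by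
  have hn : (condVerts G lab a b).ncard = n :=
    (h.2.2 a b hab).trans (by simp [hlab])
  obtain rfl | hpos := n.eq_zero_or_pos
  · rw [Nat.cast_zero, Set.encard_eq_zero, Set.eq_empty_iff_forall_notMem]
    rintro w ⟨hwa, -, hlt, -⟩
    have := h.1 s(w, a) hwa
    lia
  · rw [← (Set.finite_of_ncard_pos (hn.symm ▸ hpos)).cast_ncard_eq, hn]

lemma lab_lt_of_triangle (h : MATLabeling G lab) {x y z : V} (hxy : G.Adj x y)
    (hxz : G.Adj x z) (hyz : G.Adj y z) (h1 : lab s(x, z) ≤ lab s(x, y))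
    (h2 : lab s(y, z) ≤ lab s(x, y)) : lab s(x, z) < lab s(x, y) := by
  classical
  refine h1.lt_of_ne fun he => ?_
  have hac := h.2.1 (lab s(x, y)) s(y, z) hyz h2
  refine hac.cliqueFree le_rfl {x, y, z} ?_
  rw [SimpleGraph.is3Clique_triple_iff]
  simp [hxy, hxz, he, hxy.ne, hxz.ne, hyz.ne]

lemma isAcyclic_levelGraph (h : MATLabeling G lab) (n : ℕ) : (levelGraph G lab n).IsAcyclic := by
  rw [SimpleGraph.isAcyclic_iff_forall_adj_isBridge]
  intro a b hab
  refine SimpleGraph.isAcyclic_iff_forall_adj_isBridge.1 ?_ hab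
  refine (h.2.1 n s(a, b) hab.1 hab.2.le).anti fun x y hxy => ?_
  rw [SimpleGraph.fromEdgeSet_adj]
  exact ⟨.inl hxy, hxy.ne⟩

/-- An edge of maximal label in a clique generates a principal clique containing it. -/
lemma exists_mem_condVerts_of_isClique (h : MATLabeling G lab) {n : ℕ} {Q : Finset V}
    (hQ : (lowGraph G lab n).IsClique Q) (hcard : 1 < Q.card) :
    ∃ a ∈ Q, ∃ b ∈ Q, G.Adj a b ∧ lab s(a, b) ≤ n ∧
      ∀ c ∈ Q, c ≠ a → c ≠ b → c ∈ condVerts G lab a b := by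
  classical
  obtain ⟨u, hu, v, hv, huv⟩ := Finset.one_lt_card.1 hcard
  obtain ⟨⟨a, b⟩, hab, hmax⟩ := Q.offDiag.exists_max_image (fun p => lab s(p.1, p.2))
    ⟨(u, v), by simp [hu, hv, huv]⟩
  simp only [Finset.mem_offDiag, Prod.forall, and_imp] at hab hmax
  obtain ⟨ha, hb, hne⟩ := hab
  have hadj : ∀ {x y}, x ∈ Q → y ∈ Q → x ≠ y → G.Adj x y := fun hx hy h => (hQ hx hy h).1
  refine ⟨a, ha, b, hb, hadj ha hb hne, (hQ ha hb hne).2, fun c hc hca hcb => ?_⟩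
  refine ⟨hadj hc ha hca, hadj hc hb hcb, ?_, ?_⟩
  · rw [Sym2.eq_swap (a := c)]
    exact h.lab_lt_of_triangle (hadj ha hb hne) (hadj ha hc hca.symm) (hadj hb hc hcb.symm)
      (hmax a c ha hc hca.symm) (hmax b c hb hc hcb.symm)
  · rw [Sym2.eq_swap (a := c), Sym2.eq_swap (a := a)]
    refine h.lab_lt_of_triangle (hadj hb ha hne.symm) (hadj hb hc hcb.symm)
      (hadj ha hc hca.symm) ?_ ?_ <;> rw [Sym2.eq_swap (a := b) (b := a)]
    exacts [hmax b c hb hc hcb.symm, hmax a c ha hc hca.symm]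

/-- A clique with labels at most `n` and at least `n + 1` vertices consists of an edge of label
`n` and its conditioning vertices. -/
lemma exists_condVerts_eq (h : MATLabeling G lab) {n : ℕ} {Q : Finset V}
    (hQ : (lowGraph G lab n).IsClique Q) (hcard : 1 < Q.card) (hn : n + 1 ≤ Q.card) :
    Q.card = n + 1 ∧ ∃ a ∈ Q, ∃ b ∈ Q, G.Adj a b ∧ lab s(a, b) = n ∧
      (∀ c, c ∈ condVerts G lab a b ↔ c ∈ Q ∧ c ≠ a ∧ c ≠ b) := by
  classical
  obtain ⟨a, ha, b, hb, hab, hle, hsub⟩ := h.exists_mem_condVerts_of_isClique hQ hcard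
  obtain ⟨m, hm⟩ : ∃ m, lab s(a, b) = m + 1 := ⟨_, (Nat.sub_add_cancel (h.1 _ hab)).symm⟩
  have henc := h.encard_condVerts hab hm
  have hcardE : ((Q.erase a).erase b).card = Q.card - 2 := by
    rw [Finset.card_erase_of_mem (by simp [hb, hab.ne']), Finset.card_erase_of_mem ha]
    lia
  have hsub' : (((Q.erase a).erase b : Finset V) : Set V) ⊆ condVerts G lab a b := by
    intro c hc
    simp only [Finset.coe_erase, Set.mem_sdiff, Finset.mem_coe, Set.mem_singleton_iff] at hc
    exact hsub c hc.1.1 hc.1.2 hc.2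
  have hle' : Q.card - 2 ≤ m := by
    have := Set.encard_le_encard hsub'
    rw [Set.encard_coe_eq_coe_finsetCard, henc, hcardE] at this
    exact_mod_cast this
  have heq := (Set.finite_of_encard_eq_coe henc).eq_of_subset_of_encard_le' hsub' (by
    rw [Set.encard_coe_eq_coe_finsetCard, henc, hcardE]
    norm_cast
    lia)
  refine ⟨by lia, a, ha, b, hb, hab, by lia, fun c => ?_⟩
  rw [← heq]
  simp
  tauto

lemma cliqueFree_lowGraph (h : MATLabeling G lab) (n : ℕ) :
    (lowGraph G lab n).CliqueFree (n + 2) := by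
  intro Q hQ
  have := (h.exists_condVerts_eq hQ.isClique (by rw [hQ.card_eq]; lia)
    (by rw [hQ.card_eq]; lia)).1
  rw [hQ.card_eq] at this
  lia

lemma neighborConnected_lowGraph (h : MATLabeling G lab) (n : ℕ) :
    (lowGraph G lab n).NeighborConnected := by
  induction n with
  | zero =>
    intro X s a b _ hsa
    have := h.1 s(s, a) hsa.1
    have := hsa.2
    lia
  | succ n ih =>
    have hsup : lowGraph G lab (n + 1) = lowGraph G lab n ⊔ levelGraph G lab (n + 1) := by
      ext x y
      simp only [lowGraph, levelGraph, SimpleGraph.sup_adj, ← and_or_left, Nat.le_succ_iff]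
    rw [hsup]
    refine ih.sup (h.cliqueFree_lowGraph n) (h.isAcyclic_levelGraph _) fun a b hab => ⟨?_, ?_⟩
    · intro h'
      have := h'.2
      have := hab.2
      lia
    · rw [← condVerts_eq_commonNeighbors hab.2, h.encard_condVerts hab.1 hab.2]

lemma isClique_condVerts (h : MATLabeling G lab) {n : ℕ} {a b : V} (hab : G.Adj a b)
    (hlab : lab s(a, b) = n + 1) : (lowGraph G lab n).IsClique (condVerts G lab a b) := by
  rw [condVerts_eq_commonNeighbors hlab]
  refine (h.neighborConnected_lowGraph n).isClique_commonNeighbors hab.ne fun h' => ?_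
  have := h'.2
  lia

lemma adj_lowGraph_of_mem_principalClique (h : MATLabeling G lab) {n : ℕ} {i j a b : V}
    (hij : G.Adj i j) (hlab : lab s(i, j) = n + 1) (ha : a ∈ principalClique G lab i j)
    (hb : b ∈ principalClique G lab i j) (hab : a ≠ b) (hne : s(a, b) ≠ s(i, j)) :
    (lowGraph G lab n).Adj a b := by
  have hc : ∀ c ∈ condVerts G lab i j,
      (lowGraph G lab n).Adj c i ∧ (lowGraph G lab n).Adj c j := by
    rintro c ⟨h1, h2, h3, h4⟩
    exact ⟨⟨h1, by lia⟩, ⟨h2, by lia⟩⟩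
  obtain (rfl | rfl) | ha := ha <;> obtain (rfl | rfl) | hb := hb
  · exact absurd rfl hab
  · exact absurd rfl hne
  · exact (hc b hb).1.symm
  · exact absurd Sym2.eq_swap hne
  · exact absurd rfl hab
  · exact (hc b hb).2.symm
  · exact (hc a ha).1
  · exact (hc a ha).2
  · exact h.isClique_condVerts hij hlab ha hb hab

/-- A clique with labels at most `n` and `n + 1` vertices contains the conditioning vertices of
each of its edges. -/
lemma condVerts_subset_of_isNClique (h : MATLabeling G lab) {n : ℕ} {Q : Finset V}
    (hQ : (lowGraph G lab n).IsNClique (n + 1) Q) {a b : V} (ha : a ∈ Q) (hb : b ∈ Q)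
    (hab : a ≠ b) : condVerts G lab a b ⊆ Q := by
  classical
  induction n generalizing Q with
  | zero => exact absurd (Finset.card_le_one.1 hQ.card_eq.le a ha b hb) hab
  | succ n ih =>
    obtain ⟨-, i, hi, j, hj, hij, hlab, hmem⟩ := h.exists_condVerts_eq hQ.isClique
      (by rw [hQ.card_eq]; lia) hQ.card_eq.ge
    have hQK : ∀ c ∈ Q, c ∈ principalClique G lab i j := by
      intro c hc
      rw [principalClique, Set.mem_union, hmem]
      grind
    have key : ∀ x ∈ Q, x = i ∨ x = j → a ≠ x → b ≠ x → condVerts G lab a b ⊆ Q := by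
      intro x hx hxij hax hbx
      refine (ih (Q := Q.erase x) ⟨?_, ?_⟩ ?_ ?_).trans (by simp)
      · intro u hu v hv huv
        have hu := Finset.mem_erase.1 hu
        have hv := Finset.mem_erase.1 hv
        refine h.adj_lowGraph_of_mem_principalClique hij hlab (hQK u hu.2) (hQK v hv.2) huv
          fun he => ?_
        rw [Sym2.eq_iff] at he
        obtain ⟨rfl, rfl⟩ | ⟨rfl, rfl⟩ := he <;> tauto
      · rw [Finset.card_erase_of_mem hx, hQ.card_eq]
        lia
      · simp [ha, hax]
      · simp [hb, hbx]
    by_cases hi1 : a ≠ i ∧ b ≠ i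
    · exact key i hi (.inl rfl) hi1.1 hi1.2
    by_cases hj1 : a ≠ j ∧ b ≠ j
    · exact key j hj (.inr rfl) hj1.1 hj1.2
    have hcond : condVerts G lab i j ⊆ Q := fun c hc => ((hmem c).1 hc).1
    have hswap : condVerts G lab j i = condVerts G lab i j := by
      ext c
      simp only [condVerts, Set.mem_ofPred_eq, Sym2.eq_swap (a := j) (b := i)]
      tauto
    have := hij.ne
    obtain ⟨rfl, rfl⟩ | ⟨rfl, rfl⟩ : (a = i ∧ b = j) ∨ (a = j ∧ b = i) := by grind
    · exact hcond
    · exact hswap ▸ hcond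

/-- The restriction of an MAT-labeling to a set of vertices which contains the conditioning
vertices of each edge between its elements is an MAT-labeling. -/
lemma induce (h : MATLabeling G lab) {K : Set V}
    (hK : ∀ a ∈ K, ∀ b ∈ K, G.Adj a b → condVerts G lab a b ⊆ K) :
    MATLabeling (G.induce K) (fun e => lab (Sym2.map Subtype.val e)) := by
  have hedge : ∀ e : Sym2 K, e ∈ (G.induce K).edgeSet ↔ Sym2.map Subtype.val e ∈ G.edgeSet := by
    intro e
    induction e with | _ a b
    simp
  refine ⟨fun e he => h.1 _ ((hedge e).1 he), fun k e he hk => ?_, fun a b hab => ?_⟩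
  · refine ((h.2.1 k _ ((hedge e).1 he) hk).induce K).anti fun x y hxy => ?_
    rw [SimpleGraph.fromEdgeSet_adj] at hxy
    rw [SimpleGraph.comap_adj, SimpleGraph.fromEdgeSet_adj]
    refine ⟨?_, fun h' => hxy.2 (Subtype.ext h')⟩
    obtain ⟨h1 | h1, -⟩ := hxy
    · exact .inl h1
    · exact .inr (by rw [← h1]; rfl)
  · have hab' : G.Adj a b := hab
    refine Eq.trans ?_ (h.2.2 a b hab')
    have := hK a a.2 b b.2 hab'
    rw [← Set.ncard_image_of_injective _ Subtype.val_injective]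
    congr 1
    ext w
    constructor
    · rintro ⟨w, hw, rfl⟩
      exact hw
    · exact fun hw => ⟨⟨w, this hw⟩, hw, rfl⟩

end MATLabeling

/-- For an edge `e = {i, j}` of an MAT-labeled graph, the set `K_e` consisting of the
endpoints of `e` and the conditioning vertices of `e` is a clique, the restriction of the
labeling to `G[K_e]` is an MAT-labeling, and every edge of `G[K_e]` other than `e` has
label smaller than `lab e`. -/
theorem principalClique_isClique_MATLabeling {V : Type*} (G : SimpleGraph V)
    (lab : Sym2 V → ℕ) (h : MATLabeling G lab) (i j : V) (hij : G.Adj i j) :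
    G.IsClique (principalClique G lab i j) ∧
    MATLabeling (G.induce (principalClique G lab i j))
      (fun e => lab (Sym2.map Subtype.val e)) ∧
    (∀ a b : V, a ∈ principalClique G lab i j → b ∈ principalClique G lab i j →
      G.Adj a b → s(a, b) ≠ s(i, j) → lab s(a, b) < lab s(i, j)) := by
  classical
  obtain ⟨n, hn⟩ : ∃ n, lab s(i, j) = n + 1 := ⟨_, (Nat.sub_add_cancel (h.1 _ hij)).symm⟩
  have hlow : (MATLabeling.lowGraph G lab (n + 1)).IsClique (principalClique G lab i j) := by
    intro a ha b hb hab
    by_cases he : s(a, b) = s(i, j)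
    · refine ⟨?_, by rw [he, hn]⟩
      rwa [← SimpleGraph.mem_edgeSet, he]
    · have := h.adj_lowGraph_of_mem_principalClique hij hn ha hb hab he
      exact ⟨this.1, this.2.trans n.le_succ⟩
  refine ⟨fun a ha b hb hab => (hlow ha hb hab).1, h.induce fun a ha b hb hab => ?_,
    fun a b ha hb hab hne => ?_⟩
  · have henc := h.encard_condVerts hij hn
    obtain ⟨S, hS⟩ := (Set.finite_of_encard_eq_coe henc).exists_finset_coe
    have hQ : ((insert i (insert j S) : Finset V) : Set V) = principalClique G lab i j := by
      rw [principalClique, ← hS]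
      ext
      simp [or_assoc]
    have hiS : i ∉ S := fun hi => by
      rw [← Finset.mem_coe, hS] at hi
      exact hi.1.ne rfl
    have hjS : j ∉ S := fun hj => by
      rw [← Finset.mem_coe, hS] at hj
      exact hj.2.1.ne rfl
    rw [← hQ] at ha hb hlow ⊢
    refine h.condVerts_subset_of_isNClique ⟨hlow, ?_⟩ ha hb hab.ne
    rw [← hS, Set.encard_coe_eq_coe_finsetCard, Nat.cast_inj] at henc
    rw [Finset.card_insert_of_notMem (by simp [hij.ne, hiS]), Finset.card_insert_of_notMem hjS,
      henc]
  · have := (h.adj_lowGraph_of_mem_principalClique hij hn ha hb hab.ne hne).2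
    lia
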